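/- Let G be a finite simple graph and let A, B ⊆ V(G) be disjoint vertex sets. Then there exists a unique minimum (A,B)-cut K furthest from A, i.e., a unique minimum (A,B)-cut K such that reach(A,K') ⊆ reach(A,K) for every minimum (A,B)-cut K'. -/

import Mathlib

/-- `X` is an `(A,B)`-cut in `G`: a set of edges of `G` whose deletion leaves no
connected component containing both a vertex of `A` and a vertex of `B`. -/
def IsCut {V : Type*} (G : SimpleGraph V) (A B : Set V) (X : Set (Sym2 V)) : Prop :=
  X ⊆ G.edgeSet ∧ ∀ a ∈ A, ∀ b ∈ B, ¬ (G.deleteEdges X).Reachable a b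

/-- `X` is a minimum `(A,B)`-cut: an `(A,B)`-cut of smallest possible cardinality. -/
def IsMinCut {V : Type*} (G : SimpleGraph V) (A B : Set V) (X : Set (Sym2 V)) : Prop :=
  IsCut G A B X ∧ ∀ Y : Set (Sym2 V), IsCut G A B Y → X.ncard ≤ Y.ncard

/-- `reach G A X` is the set of vertices lying in a connected component of `G − X`
containing a vertex of `A`. -/
def reach {V : Type*} (G : SimpleGraph V) (A : Set V) (X : Set (Sym2 V)) : Set V :=
  {v | ∃ a ∈ A, (G.deleteEdges X).Reachable a v}

/-- The edges of `G` with exactly one endpoint in `S`. -/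
def edgeBoundary {V : Type*} (G : SimpleGraph V) (S : Set V) : Set (Sym2 V) :=
  {e | ∃ u v, G.Adj u v ∧ u ∈ S ∧ v ∉ S ∧ e = s(u, v)}

section

variable {V : Type*} {G : SimpleGraph V} {A B S T : Set V} {X : Set (Sym2 V)}

theorem mk_mem_edgeBoundary {u v : V} :
    s(u, v) ∈ edgeBoundary G S ↔ G.Adj u v ∧ (u ∈ S ∧ v ∉ S ∨ v ∈ S ∧ u ∉ S) := by
  constructor
  · rintro ⟨x, y, hxy, hx, hy, h⟩
    rcases Sym2.eq_iff.mp h with ⟨rfl, rfl⟩ | ⟨rfl, rfl⟩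
    · exact ⟨hxy, .inl ⟨hx, hy⟩⟩
    · exact ⟨hxy.symm, .inr ⟨hx, hy⟩⟩
  · rintro ⟨h, ⟨hu, hv⟩ | ⟨hv, hu⟩⟩
    · exact ⟨u, v, h, hu, hv, rfl⟩
    · exact ⟨v, u, h.symm, hv, hu, Sym2.eq_swap⟩

theorem subset_reach (G : SimpleGraph V) (A : Set V) (X : Set (Sym2 V)) : A ⊆ reach G A X :=
  fun a ha ↦ ⟨a, ha, .rfl⟩

theorem IsCut.disjoint_reach (h : IsCut G A B X) : Disjoint (reach G A X) B :=
  Set.disjoint_left.mpr fun b ⟨a, ha, hab⟩ hb ↦ h.2 a ha b hb hab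

theorem mem_of_reachable_deleteEdges_edgeBoundary {u v : V}
    (h : (G.deleteEdges (edgeBoundary G S)).Reachable u v) (hu : u ∈ S) : v ∈ S := by
  obtain ⟨p⟩ := h
  induction p with
  | nil => exact hu
  | cons hadj _ ih =>
    rw [SimpleGraph.deleteEdges_adj, mk_mem_edgeBoundary] at hadj
    exact ih (by tauto)

theorem isCut_edgeBoundary (hA : A ⊆ S) (hB : Disjoint S B) : IsCut G A B (edgeBoundary G S) := by
  refine ⟨?_, fun a ha b hb h ↦ Set.disjoint_left.mp hB
    (mem_of_reachable_deleteEdges_edgeBoundary h (hA ha)) hb⟩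
  rintro _ ⟨u, v, huv, -, -, rfl⟩
  exact huv

theorem edgeBoundary_reach_subset : edgeBoundary G (reach G A X) ⊆ X := by
  rintro _ ⟨u, v, huv, ⟨a, ha, hau⟩, hv, rfl⟩
  by_contra hX
  exact hv ⟨a, ha, hau.trans (SimpleGraph.deleteEdges_adj.mpr ⟨huv, hX⟩).reachable⟩

theorem reach_subset_reach_edgeBoundary (h : reach G A X ⊆ S) :
    reach G A X ⊆ reach G A (edgeBoundary G S) := by
  have key : ∀ u v, (G.deleteEdges X).Walk u v → u ∈ reach G A X →
      (G.deleteEdges (edgeBoundary G S)).Reachable u v := by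
    intro u v p
    induction p with
    | nil => exact fun _ ↦ .rfl
    | cons hadj _ ih =>
      rintro ⟨a, ha, hau⟩
      have hw := hau.trans hadj.reachable
      refine SimpleGraph.Reachable.trans (SimpleGraph.Adj.reachable ?_) (ih ⟨a, ha, hw⟩)
      have hu := h ⟨a, ha, hau⟩
      have hv := h ⟨a, ha, hw⟩
      rw [SimpleGraph.deleteEdges_adj] at hadj ⊢
      exact ⟨hadj.1, by rw [mk_mem_edgeBoundary]; tauto⟩
  rintro v ⟨a, ha, ⟨p⟩⟩
  exact ⟨a, ha, key a v p (subset_reach G A X ha)⟩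

theorem ncard_edgeBoundary_union_add_inter_le [Finite V] (G : SimpleGraph V) (S T : Set V) :
    (edgeBoundary G (S ∪ T)).ncard + (edgeBoundary G (S ∩ T)).ncard ≤
      (edgeBoundary G S).ncard + (edgeBoundary G T).ncard := by
  rw [← Set.ncard_union_add_ncard_inter, ← Set.ncard_union_add_ncard_inter (edgeBoundary G S)]
  refine add_le_add (Set.ncard_le_ncard ?_) (Set.ncard_le_ncard ?_) <;>
  · intro e
    induction e with
    | _ u v =>
      simp only [Set.mem_union, Set.mem_inter_iff, mk_mem_edgeBoundary]
      tauto

theorem IsMinCut.eq_edgeBoundary_reach [Finite V] (h : IsMinCut G A B X) :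
    edgeBoundary G (reach G A X) = X :=
  Set.eq_of_subset_of_ncard_le edgeBoundary_reach_subset
    (h.2 _ (isCut_edgeBoundary (subset_reach G A X) h.1.disjoint_reach))

theorem IsMinCut.edgeBoundary_union [Finite V] (hA : A ⊆ S ∩ T) (hB : Disjoint (S ∪ T) B)
    (hS : IsMinCut G A B (edgeBoundary G S)) (hT : IsMinCut G A B (edgeBoundary G T)) :
    IsMinCut G A B (edgeBoundary G (S ∪ T)) := by
  have hST : S ∩ T ⊆ S ∪ T := Set.inter_subset_left.trans Set.subset_union_left
  refine ⟨isCut_edgeBoundary (hA.trans hST) hB, fun Y hY ↦ ?_⟩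
  have hsub := ncard_edgeBoundary_union_add_inter_le G S T
  have hinter := hT.2 _ (isCut_edgeBoundary hA (hB.mono_left hST))
  have hle := hS.2 Y hY
  omega

theorem exists_isMinCut [Finite V] (G : SimpleGraph V) (hAB : Disjoint A B) :
    ∃ K, IsMinCut G A B K :=
  Set.exists_min_image {X | IsCut G A B X} Set.ncard (Set.toFinite _)
    ⟨_, isCut_edgeBoundary subset_rfl hAB⟩

theorem IsMinCut.exists_reach_union_subset [Finite V] {K K' : Set (Sym2 V)}
    (hK : IsMinCut G A B K) (hK' : IsMinCut G A B K') :
    ∃ L, IsMinCut G A B L ∧ reach G A K ∪ reach G A K' ⊆ reach G A L := by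
  refine ⟨edgeBoundary G (reach G A K ∪ reach G A K'), ?_, Set.union_subset
    (reach_subset_reach_edgeBoundary Set.subset_union_left)
    (reach_subset_reach_edgeBoundary Set.subset_union_right)⟩
  refine IsMinCut.edgeBoundary_union
    (Set.subset_inter (subset_reach G A K) (subset_reach G A K'))
    (Set.disjoint_union_left.mpr ⟨hK.1.disjoint_reach, hK'.1.disjoint_reach⟩) ?_ ?_
  · rwa [hK.eq_edgeBoundary_reach]
  · rwa [hK'.eq_edgeBoundary_reach]

end

/-- For disjoint vertex sets `A`, `B` of a finite simple graph `G`,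
there is a unique minimum `(A,B)`-cut `K` furthest from `A`, i.e. a unique minimum
`(A,B)`-cut `K` with `reach(A,K') ⊆ reach(A,K)` for every minimum `(A,B)`-cut `K'`. -/
theorem existsUnique_furthest_minCut {V : Type*} [Fintype V] (G : SimpleGraph V)
    (A B : Set V) (hAB : Disjoint A B) :
    ∃! K : Set (Sym2 V), IsMinCut G A B K ∧
      ∀ K' : Set (Sym2 V), IsMinCut G A B K' → reach G A K' ⊆ reach G A K := by
  obtain ⟨K, hK, hmax⟩ := Set.exists_max_image {X | IsMinCut G A B X}
    (fun X ↦ (reach G A X).ncard) (Set.toFinite _) (exists_isMinCut G hAB)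
  have hfar : ∀ K', IsMinCut G A B K' → reach G A K' ⊆ reach G A K := by
    intro K' hK'
    obtain ⟨L, hL, hsub⟩ := IsMinCut.exists_reach_union_subset hK hK'
    rw [Set.union_subset_iff] at hsub
    rw [Set.eq_of_subset_of_ncard_le hsub.1 (hmax L hL)]
    exact hsub.2
  refine ⟨K, ⟨hK, hfar⟩, fun K' ⟨hK', hfar'⟩ ↦ ?_⟩
  rw [← hK'.eq_edgeBoundary_reach, (hfar K' hK').antisymm (hfar' K hK), hK.eq_edgeBoundary_reach]
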